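/- Let E be a real inner product space (e.g., ℝ^d with the Euclidean inner product), let L : E → ℝ be differentiable at θ ∈ E with gradient ∇L(θ). Then the worst-case loss over a shrinking ball satisfies the first-order expansion: ( sup_{‖ε‖ ≤ ρ} L(θ + ε) − L(θ) ) / ρ → ‖∇L(θ)‖ as ρ → 0⁺. Equivalently, sup_{‖ε‖ ≤ ρ} L(θ+ε) = L(θ) + ρ·‖∇L(θ)‖ + o(ρ) as ρ → 0⁺. -/

import Mathlib

open Filter Asymptotics

/-- **First-order expansion of the SAM worst-case loss** over a shrinking ball: if `L` is
differentiable at `θ` with gradient `∇L(θ)`, then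
`(sup_{‖ε‖ ≤ ρ} L(θ+ε) − L(θ))/ρ → ‖∇L(θ)‖` as `ρ → 0⁺`; equivalently,
`sup_{‖ε‖ ≤ ρ} L(θ+ε) = L(θ) + ρ‖∇L(θ)‖ + o(ρ)` as `ρ → 0⁺`. -/
theorem sam_worst_case_first_order_expansion
    {E : Type*} [NormedAddCommGroup E] [InnerProductSpace ℝ E] [CompleteSpace E]
    (L : E → ℝ) (θ : E) (hL : DifferentiableAt ℝ L θ) :
    Tendsto
      (fun ρ : ℝ =>
        ((⨆ ε : Metric.closedBall (0 : E) ρ, L (θ + ε)) - L θ) / ρ)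
      (nhdsWithin 0 (Set.Ioi 0)) (nhds ‖gradient L θ‖) ∧
    (fun ρ : ℝ =>
        (⨆ ε : Metric.closedBall (0 : E) ρ, L (θ + ε)) - (L θ + ρ * ‖gradient L θ‖))
      =o[nhdsWithin 0 (Set.Ioi 0)] (fun ρ : ℝ => ρ) := by
  have key : (fun ρ : ℝ =>
        (⨆ ε : Metric.closedBall (0 : E) ρ, L (θ + ε)) - (L θ + ρ * ‖gradient L θ‖))
      =o[nhdsWithin 0 (Set.Ioi 0)] (fun ρ : ℝ => ρ) := by
    have hg := hL.hasGradientAt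
    generalize gradient L θ = g at hg
    have h1 := hasGradientAt_iff_isLittleO.1 hg
    rw [isLittleO_iff]
    intro c hc
    have h2 := isLittleO_iff.1 h1 hc
    obtain ⟨δ, hδ, h3⟩ := Metric.eventually_nhds_iff.1 h2
    have h4 : ∀ e : E, ‖e‖ < δ → |L (θ + e) - L θ - inner ℝ g e| ≤ c * ‖e‖ := by
      intro e he
      have := @h3 (θ + e) (by simpa [dist_eq_norm] using he)
      simpa using this
    filter_upwards [Ioo_mem_nhdsGT hδ] with ρ hρ
    obtain ⟨hρ0, hρδ⟩ := hρ
    have hub : ∀ e : Metric.closedBall (0 : E) ρ, L (θ + e) ≤ L θ + ρ * ‖g‖ + c * ρ := by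
      rintro ⟨e, he⟩
      have he' : ‖e‖ ≤ ρ := by simpa using he
      have a := (abs_le.1 (h4 e (by linarith))).2
      have b := real_inner_le_norm g e
      have b2 : ‖g‖ * ‖e‖ ≤ ‖g‖ * ρ := by gcongr
      have b3 : c * ‖e‖ ≤ c * ρ := by gcongr
      show L (θ + e) ≤ _
      linarith
    have : Nonempty (Metric.closedBall (0 : E) ρ) := ⟨⟨0, by simpa using hρ0.le⟩⟩
    have hup := ciSup_le hub
    have hn : ‖(ρ / ‖g‖) • g‖ ≤ ρ := by
      rw [norm_smul, Real.norm_of_nonneg (by positivity)]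
      by_cases h0 : ‖g‖ = 0
      · simpa [h0] using hρ0.le
      · rw [div_mul_cancel₀ _ h0]
    have hi : inner ℝ g ((ρ / ‖g‖) • g) = ρ * ‖g‖ := by
      rw [real_inner_smul_right, real_inner_self_eq_norm_sq]
      by_cases h0 : ‖g‖ = 0
      · simp [h0]
      · field_simp
    have hlo : L (θ + (ρ / ‖g‖) • g) ≤ ⨆ ε : Metric.closedBall (0 : E) ρ, L (θ + ε) :=
      le_ciSup (f := fun ε : Metric.closedBall (0 : E) ρ => L (θ + ε))
        ⟨_, Set.forall_mem_range.2 hub⟩ ⟨(ρ / ‖g‖) • g, by simpa using hn⟩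
    have a := (abs_le.1 (h4 _ (hn.trans_lt hρδ))).1
    rw [hi] at a
    have b3 : c * ‖(ρ / ‖g‖) • g‖ ≤ c * ρ := by gcongr
    rw [Real.norm_eq_abs, Real.norm_of_nonneg hρ0.le, abs_le]
    constructor <;> linarith
  refine ⟨?_, key⟩
  have h := key.tendsto_div_nhds_zero.add_const ‖gradient L θ‖
  rw [zero_add] at h
  refine h.congr' ?_
  filter_upwards [self_mem_nhdsWithin] with ρ hρ
  have : ρ ≠ 0 := ne_of_gt hρ
  field_simp
  ring
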